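/- For all smooth compactly supported functions F, H, K on ℝ^(2n+1), the contact bracket satisfies the integral identity ∫_{ℝ^(2n+1)} {F,H}^c K dλ = ∫_{ℝ^(2n+1)} F {H,K}^c dλ + (n+3) ∫_{ℝ^(2n+1)} F K (∂H/∂z) dλ, where λ is Lebesgue measure (a constant multiple of the contact volume dη^n ∧ η in Darboux coordinates). Consequently ∫ X^c_H(F) K dλ = ∫ F {H,K}^c dλ + (n+2) ∫ F K (∂H/∂z) dλ. -/

import Mathlib

open MeasureTheory

noncomputable section

/-- The contact phase space `ℝ^(2n+1)` with coordinates `(q, p, z)`. -/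
abbrev Nc (n : ℕ) : Type := (Fin n → ℝ) × (Fin n → ℝ) × ℝ

/-- Coordinate direction `∂/∂qⁱ`. -/
def eQ (n : ℕ) (i : Fin n) : Nc n := (Pi.single i 1, 0, 0)

/-- Coordinate direction `∂/∂pᵢ`. -/
def eP (n : ℕ) (i : Fin n) : Nc n := (0, Pi.single i 1, 0)

/-- Coordinate direction `∂/∂z` (the Reeb field). -/
def eZ (n : ℕ) : Nc n := (0, 0, 1)

/-- Partial derivative of `F` in the direction `v`. -/
def pd {n : ℕ} (F : Nc n → ℝ) (v : Nc n) (x : Nc n) : ℝ := fderiv ℝ F x v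

/-- The contact (Jacobi) bracket. -/
def cBracket {n : ℕ} (F H : Nc n → ℝ) : Nc n → ℝ :=
  fun x => (∑ i, (pd F (eQ n i) x * pd H (eP n i) x - pd F (eP n i) x * pd H (eQ n i) x))
    + (F x - ∑ i, x.2.1 i * pd F (eP n i) x) * pd H (eZ n) x
    - (H x - ∑ i, x.2.1 i * pd H (eP n i) x) * pd F (eZ n) x

/-- The contact Hamiltonian vector field `X^c_H`. -/
def Xc {n : ℕ} (H : Nc n → ℝ) : Nc n → Nc n :=
  fun x => (fun i => pd H (eP n i) x,
            fun i => - (pd H (eQ n i) x + x.2.1 i * pd H (eZ n) x),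
            (∑ i, x.2.1 i * pd H (eP n i) x) - H x)

lemma pd_smooth {n : ℕ} {F : Nc n → ℝ} (hF : ContDiff ℝ (⊤ : ℕ∞) F) (v : Nc n) :
    ContDiff ℝ (⊤ : ℕ∞) (pd F v) := by
  have h : ContDiff ℝ (⊤ : ℕ∞) (fderiv ℝ F) := hF.fderiv_right (by simp)
  exact h.clm_apply contDiff_const

lemma pd_compact {n : ℕ} {F : Nc n → ℝ} (hF : HasCompactSupport F) (v : Nc n) :
    HasCompactSupport (pd F v) := hF.fderiv_apply ℝ v

lemma pd_integrable {n : ℕ} {F : Nc n → ℝ} (hF : ContDiff ℝ (⊤ : ℕ∞) F)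
    (hc : HasCompactSupport F) (v : Nc n) : Integrable (pd F v) :=
  (pd_smooth hF v).continuous.integrable_of_hasCompactSupport (pd_compact hc v)

lemma integral_pd {n : ℕ} {F : Nc n → ℝ} (hF : ContDiff ℝ (⊤ : ℕ∞) F)
    (hc : HasCompactSupport F) (v : Nc n) : ∫ x, pd F v x = 0 := by
  haveI i1 : (volume : Measure ((Fin n → ℝ) × ℝ)).IsAddHaarMeasure :=
    Measure.prod.instIsAddHaarMeasure (volume : Measure (Fin n → ℝ)) (volume : Measure ℝ)
  haveI i2 : (volume : Measure (Nc n)).IsAddHaarMeasure :=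
    Measure.prod.instIsAddHaarMeasure (volume : Measure (Fin n → ℝ))
      (volume : Measure ((Fin n → ℝ) × ℝ))
  have hone : Differentiable ℝ (fun _ : Nc n => (1 : ℝ)) := differentiable_const _
  have h := integral_mul_fderiv_eq_neg_fderiv_mul_of_integrable (μ := (volume : Measure (Nc n)))
    (f := fun _ : Nc n => (1 : ℝ)) (g := F) (v := v) (by simp)
    (by simp only [one_mul]; exact pd_integrable hF hc v)
    (by simpa using hF.continuous.integrable_of_hasCompactSupport hc)
    (fun x _ => hone x) (fun x _ => hF.differentiable (by simp) x)
  simpa [pd] using h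

lemma pd_mul {n : ℕ} {F G : Nc n → ℝ} (hF : ContDiff ℝ (⊤ : ℕ∞) F)
    (hG : ContDiff ℝ (⊤ : ℕ∞) G) (v x : Nc n) :
    pd (fun y => F y * G y) v x = F x * pd G v x + G x * pd F v x := by
  have h1 : DifferentiableAt ℝ F x := hF.differentiable (by simp) x
  have h2 : DifferentiableAt ℝ G x := hG.differentiable (by simp) x
  simp [pd, fderiv_fun_mul h1 h2]

lemma pd_add {n : ℕ} {F G : Nc n → ℝ} (hF : ContDiff ℝ (⊤ : ℕ∞) F)
    (hG : ContDiff ℝ (⊤ : ℕ∞) G) (v x : Nc n) :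
    pd (fun y => F y + G y) v x = pd F v x + pd G v x := by
  have h1 : DifferentiableAt ℝ F x := hF.differentiable (by simp) x
  have h2 : DifferentiableAt ℝ G x := hG.differentiable (by simp) x
  simp [pd, fderiv_fun_add h1 h2]

lemma pd_comm {n : ℕ} {F : Nc n → ℝ} (hF : ContDiff ℝ (⊤ : ℕ∞) F) (v w x : Nc n) :
    pd (pd F v) w x = pd (pd F w) v x := by
  have h : ContDiff ℝ (⊤ : ℕ∞) (fderiv ℝ F) := hF.fderiv_right (by simp)
  have hd : DifferentiableAt ℝ (fderiv ℝ F) x := h.differentiable (by simp) x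
  have key : ∀ v w : Nc n, pd (pd F v) w x = fderiv ℝ (fderiv ℝ F) x w v := by
    intro v w
    have : HasFDerivAt (fun y => fderiv ℝ F y v) _ x :=
      hd.hasFDerivAt.clm_apply (hasFDerivAt_const v x)
    show fderiv ℝ (fun y => fderiv ℝ F y v) x w = _
    rw [this.fderiv]
    simp
  rw [key, key]
  have hs : IsSymmSndFDerivAt ℝ F x := hF.contDiffAt.isSymmSndFDerivAt (by
    rw [minSmoothness_of_isRCLikeNormedField]
    exact WithTop.coe_le_coe.2 le_top)
  exact hs w v

lemma coord_smooth {n : ℕ} (i : Fin n) : ContDiff ℝ (⊤ : ℕ∞) (fun x : Nc n => x.2.1 i) := by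
  fun_prop

lemma pd_coord {n : ℕ} (i : Fin n) (v x : Nc n) :
    pd (fun x : Nc n => x.2.1 i) v x = v.2.1 i := by
  let L : Nc n →L[ℝ] ℝ := (ContinuousLinearMap.proj i).comp
    ((ContinuousLinearMap.fst ℝ (Fin n → ℝ) ℝ).comp
      (ContinuousLinearMap.snd ℝ (Fin n → ℝ) ((Fin n → ℝ) × ℝ)))
  show fderiv ℝ (fun x => L x) x v = L v
  rw [L.fderiv]

lemma vec_decomp {n : ℕ} (v : Nc n) :
    v = (∑ i, v.1 i • eQ n i) + (∑ i, v.2.1 i • eP n i) + v.2.2 • eZ n := by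
  refine Prod.ext ?_ (Prod.ext ?_ ?_)
  · ext j
    simp [eQ, eP, eZ, Prod.fst_sum, Prod.snd_sum, Finset.sum_apply, Pi.single_apply]
  · ext j
    simp [eQ, eP, eZ, Prod.fst_sum, Prod.snd_sum, Finset.sum_apply, Pi.single_apply]
  · simp [eQ, eP, eZ, Prod.fst_sum, Prod.snd_sum]

lemma fderiv_Xc {n : ℕ} (F H : Nc n → ℝ) (x : Nc n) :
    fderiv ℝ F x (Xc H x) = ∑ i, (pd H (eP n i) x * pd F (eQ n i) x
      - (pd H (eQ n i) x + x.2.1 i * pd H (eZ n) x) * pd F (eP n i) x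
      + x.2.1 i * pd H (eP n i) x * pd F (eZ n) x) - H x * pd F (eZ n) x := by
  rw [vec_decomp (Xc H x)]
  simp only [map_add, map_sum, map_smul, smul_eq_mul, Xc]
  simp only [pd, Finset.sum_add_distrib, Finset.sum_sub_distrib, neg_mul,
    Finset.sum_neg_distrib, sub_mul, Finset.sum_mul]
  ring

lemma bracket_eq {n : ℕ} (F H : Nc n → ℝ) (x : Nc n) :
    cBracket F H x = fderiv ℝ F x (Xc H x) + F x * pd H (eZ n) x := by
  rw [fderiv_Xc]
  simp only [cBracket, Finset.sum_add_distrib, Finset.sum_sub_distrib, add_mul, sub_mul,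
    Finset.sum_mul]
  have e1 : ∀ i : Fin n, pd H (eP n i) x * pd F (eQ n i) x = pd F (eQ n i) x * pd H (eP n i) x :=
    fun i => mul_comm _ _
  have e2 : ∀ i : Fin n, pd H (eQ n i) x * pd F (eP n i) x = pd F (eP n i) x * pd H (eQ n i) x :=
    fun i => mul_comm _ _
  have e3 : ∀ i : Fin n, x.2.1 i * pd H (eZ n) x * pd F (eP n i) x
      = x.2.1 i * pd F (eP n i) x * pd H (eZ n) x := fun i => by ring
  simp only [e1, e2, e3]
  ring

lemma bracket_anti {n : ℕ} (F H : Nc n → ℝ) (x : Nc n) :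
    cBracket F H x = - cBracket H F x := by
  have e : (∑ i, (pd F (eQ n i) x * pd H (eP n i) x - pd F (eP n i) x * pd H (eQ n i) x))
      = - ∑ i, (pd H (eQ n i) x * pd F (eP n i) x - pd H (eP n i) x * pd F (eQ n i) x) := by
    rw [← Finset.sum_neg_distrib]
    exact Finset.sum_congr rfl fun i _ => by ring
  simp only [cBracket]
  rw [e]
  ring

/-- Divergence theorem for the contact Hamiltonian vector field. -/
lemma integral_div {n : ℕ} {G H : Nc n → ℝ} (hG : ContDiff ℝ (⊤ : ℕ∞) G)
    (hH : ContDiff ℝ (⊤ : ℕ∞) H) (hGc : HasCompactSupport G) :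
    ∫ x, (fderiv ℝ G x (Xc H x) - ((n : ℝ) + 1) * (G x * pd H (eZ n) x)) = 0 := by
  have hz := pd_smooth hH (eZ n)
  have hq := fun i => pd_smooth hH (eQ n i)
  have hp := fun i => pd_smooth hH (eP n i)
  have hc := fun i : Fin n => coord_smooth i
  let a : Fin n → Nc n → ℝ := fun i y => G y * pd H (eP n i) y
  let b : Fin n → Nc n → ℝ := fun i y => G y * (pd H (eQ n i) y + y.2.1 i * pd H (eZ n) y)
  let c : Fin n → Nc n → ℝ := fun i y => G y * (y.2.1 i * pd H (eP n i) y)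
  let d : Nc n → ℝ := fun y => G y * H y
  have ha : ∀ i, ContDiff ℝ (⊤ : ℕ∞) (a i) := fun i => hG.mul (hp i)
  have hb : ∀ i, ContDiff ℝ (⊤ : ℕ∞) (b i) := fun i => hG.mul ((hq i).add ((hc i).mul hz))
  have hcc : ∀ i, ContDiff ℝ (⊤ : ℕ∞) (c i) := fun i => hG.mul ((hc i).mul (hp i))
  have hd : ContDiff ℝ (⊤ : ℕ∞) d := hG.mul hH
  have sa : ∀ i, HasCompactSupport (a i) := fun i => hGc.mul_right
  have sb : ∀ i, HasCompactSupport (b i) := fun i => hGc.mul_right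
  have sc : ∀ i, HasCompactSupport (c i) := fun i => hGc.mul_right
  have sd : HasCompactSupport d := hGc.mul_right
  have ia := fun i => pd_integrable (ha i) (sa i) (eQ n i)
  have ib := fun i => pd_integrable (hb i) (sb i) (eP n i)
  have ic := fun i => pd_integrable (hcc i) (sc i) (eZ n)
  have id' := pd_integrable hd sd (eZ n)
  have key : ∀ x, fderiv ℝ G x (Xc H x) - ((n : ℝ) + 1) * (G x * pd H (eZ n) x)
      = (∑ i, (pd (a i) (eQ n i) x - pd (b i) (eP n i) x + pd (c i) (eZ n) x))
        - pd d (eZ n) x := by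
    intro x
    have hi : ∀ i, pd (a i) (eQ n i) x - pd (b i) (eP n i) x + pd (c i) (eZ n) x
        = (pd H (eP n i) x * pd G (eQ n i) x
      - (pd H (eQ n i) x + x.2.1 i * pd H (eZ n) x) * pd G (eP n i) x
      + x.2.1 i * pd H (eP n i) x * pd G (eZ n) x) - G x * pd H (eZ n) x := by
      intro i
      simp only [a, b, c]
      rw [pd_mul hG (hp i), pd_mul hG ((hq i).add ((hc i).mul hz)),
        pd_mul hG ((hc i).mul (hp i)), pd_add (hq i) ((hc i).mul hz),
        pd_mul (hc i) hz, pd_mul (hc i) (hp i), pd_coord, pd_coord,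
        pd_comm hH (eP n i) (eQ n i), pd_comm hH (eP n i) (eZ n)]
      simp only [eP, eZ, Pi.single_eq_same, Pi.zero_apply]
      ring
    rw [Finset.sum_congr rfl fun i _ => hi i, Finset.sum_sub_distrib, fderiv_Xc]
    simp only [d]
    rw [pd_mul hG hH]
    simp only [Finset.sum_const, Finset.card_univ, Fintype.card_fin, nsmul_eq_mul]
    ring
  simp_rw [key]
  have ii : ∀ i, Integrable fun x =>
      pd (a i) (eQ n i) x - pd (b i) (eP n i) x + pd (c i) (eZ n) x :=
    fun i => ((ia i).sub (ib i)).add (ic i)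
  rw [integral_sub (integrable_finsetSum _ fun i _ => ii i) id',
    integral_finsetSum _ fun i _ => ii i, integral_pd hd sd, sub_zero]
  refine Finset.sum_eq_zero fun i _ => ?_
  have h1 := integral_add ((ia i).sub (ib i)) (ic i)
  have h2 := integral_sub (ia i) (ib i)
  simp only [Pi.sub_apply] at h1
  rw [h1, h2, integral_pd (ha i) (sa i), integral_pd (hb i) (sb i), integral_pd (hcc i) (sc i)]
  simp

/-- For smooth compactly supported `F, H, K` on `ℝ^(2n+1)`:
`∫ {F,H}^c K = ∫ F {H,K}^c + (n+3) ∫ F K ∂H/∂z`, and consequently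
`∫ X^c_H(F) K = ∫ F {H,K}^c + (n+2) ∫ F K ∂H/∂z` (Lebesgue measure = contact
volume up to a constant). -/
theorem contact_bracket_integral_identity (n : ℕ) (F H K : Nc n → ℝ)
    (hF : ContDiff ℝ (⊤ : ℕ∞) F) (hH : ContDiff ℝ (⊤ : ℕ∞) H) (hK : ContDiff ℝ (⊤ : ℕ∞) K)
    (hFc : HasCompactSupport F) (hHc : HasCompactSupport H) (hKc : HasCompactSupport K) :
    (∫ x, cBracket F H x * K x
      = (∫ x, F x * cBracket H K x)
        + ((n : ℝ) + 3) * ∫ x, F x * K x * pd H (eZ n) x)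
  ∧ (∫ x, fderiv ℝ F x (Xc H x) * K x
      = (∫ x, F x * cBracket H K x)
        + ((n : ℝ) + 2) * ∫ x, F x * K x * pd H (eZ n) x) := by
  have hz := (pd_smooth hH (eZ n)).continuous
  have cX : Continuous (Xc H) := by
    have h1 := fun i => (pd_smooth hH (eP n i)).continuous
    have h2 := fun i => (pd_smooth hH (eQ n i)).continuous
    have h3 := hH.continuous
    unfold Xc
    fun_prop
  have cd : ∀ {G : Nc n → ℝ}, ContDiff ℝ (⊤ : ℕ∞) G →
      Continuous fun x => fderiv ℝ G x (Xc H x) := fun hG =>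
    (hG.continuous_fderiv (by simp)).clm_apply cX
  have i1 : Integrable fun x => fderiv ℝ F x (Xc H x) * K x :=
    ((cd hF).mul hK.continuous).integrable_of_hasCompactSupport hKc.mul_left
  have i3 : Integrable fun x => F x * K x * pd H (eZ n) x :=
    ((hF.continuous.mul hK.continuous).mul hz).integrable_of_hasCompactSupport
      (HasCompactSupport.mul_right (HasCompactSupport.mul_right hFc))
  have e2 : ∀ x, cBracket H K x = - (fderiv ℝ K x (Xc H x) + K x * pd H (eZ n) x) := fun x => by
    rw [bracket_anti, bracket_eq]
  have i2 : Integrable fun x => F x * cBracket H K x := by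
    simp_rw [e2]
    exact (hF.continuous.mul ((cd hK).add (hK.continuous.mul hz)).neg).integrable_of_hasCompactSupport
      hFc.mul_right
  have hdiv := integral_div (G := fun x => F x * K x) (hF.mul hK) hH hFc.mul_right
  have e3 : ∀ x, fderiv ℝ (fun x => F x * K x) x (Xc H x)
      - ((n : ℝ) + 1) * (F x * K x * pd H (eZ n) x)
      = fderiv ℝ F x (Xc H x) * K x - F x * cBracket H K x
        - ((n : ℝ) + 2) * (F x * K x * pd H (eZ n) x) := by
    intro x
    have h := pd_mul hF hK (Xc H x) x
    simp only [pd] at h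
    rw [h, e2]
    ring
  simp_rw [e3] at hdiv
  have h1 := integral_sub (i1.sub i2) (i3.const_mul ((n : ℝ) + 2))
  have h2 := integral_sub i1 i2
  simp only [Pi.sub_apply] at h1
  rw [h1, h2, integral_const_mul] at hdiv
  have e1 : ∀ x, cBracket F H x * K x
      = fderiv ℝ F x (Xc H x) * K x + F x * K x * pd H (eZ n) x := fun x => by
    rw [bracket_eq]; ring
  simp_rw [e1]
  rw [integral_add i1 i3]
  constructor <;> linarith
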